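/- Let ψ : A → E be a *-homomorphism of C*-algebras and B a closed two-sided ideal of E. Then ψ is weakly nuclear relative to B (i.e. x ↦ ψ(x)b is nuclear for every b ∈ B) if and only if the completely positive map x ↦ b*ψ(x)b from A to B is nuclear for every b ∈ B. -/

import Mathlib

/-!
Statement 14 (Remark 5.3): for a *-homomorphism `ψ : A → E` and a closed two-sided
ideal `B ⊴ E`, the map `ψ` is weakly nuclear relative to `B` (i.e. `x ↦ ψ(x) b` is
nuclear for all `b ∈ B`) if and only if the completely positive map
`x ↦ b* ψ(x) b : A → B` is nuclear for every `b ∈ B`.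

The ideal `B` is presented abstractly via an ideal embedding `j : B → E`; the maps
`x ↦ ψ(x) b` and `x ↦ b* ψ(x) b`, viewed as linear maps with values in `B`, are any
linear maps `ρ` with `j (ρ x) = ψ x * j b`, resp. `j (ρ x) = star (j b) * ψ x * j b`.
-/

noncomputable section
open scoped TensorProduct

/-- The canonical star operation on an algebraic tensor product of C*-algebras:
an additive map `s` with `s (a ⊗ d) = a* ⊗ d*`.  (Such a map exists and is unique.) -/
def IsTensorStar {A D : Type} [NonUnitalCStarAlgebra A] [NonUnitalCStarAlgebra D]
    (s : TensorProduct ℂ A D →+ TensorProduct ℂ A D) : Prop :=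
  ∀ (a : A) (d : D), s (a ⊗ₜ[ℂ] d) = star a ⊗ₜ[ℂ] star d

/-- The star operation on an iterated algebraic tensor product `T ⊗ E`
relative to a star operation `s₂` on `T`. -/
def IsTensorStarRel {T E : Type} [AddCommMonoid T] [Module ℂ T] [NonUnitalCStarAlgebra E]
    (s₂ : T →+ T) (s₃ : TensorProduct ℂ T E →+ TensorProduct ℂ T E) : Prop :=
  ∀ (x : T) (e : E), s₃ (x ⊗ₜ[ℂ] e) = s₂ x ⊗ₜ[ℂ] star e

/-- `γ` is a C*-seminorm on the (non-unital) *-algebra `T`, with star operation `s`. -/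
structure IsCStarSeminorm {T : Type} [NonUnitalSemiring T] [Module ℂ T]
    (s : T →+ T) (γ : T → ℝ) : Prop where
  nonneg : ∀ x, 0 ≤ γ x
  add_le : ∀ x y, γ (x + y) ≤ γ x + γ y
  smul : ∀ (c : ℂ) (x), γ (c • x) = ‖c‖ * γ x
  mul_le : ∀ x y, γ (x * y) ≤ γ x * γ y
  cstar : ∀ x, γ (s x * x) = γ x ^ 2

/-- `γ` is a C*-norm on the (non-unital) *-algebra `T`, with star operation `s`. -/
structure IsCStarNorm {T : Type} [NonUnitalSemiring T] [Module ℂ T]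
    (s : T →+ T) (γ : T → ℝ) extends IsCStarSeminorm s γ : Prop where
  definite : ∀ x, γ x = 0 → x = 0

/-- `ρ ⊗ id_D : A ⊗_alg D → B ⊗_max D` is bounded by `K` for every C*-algebra `D`,
where `A ⊗_alg D` carries the minimal C*-norm.  This is encoded by quantifying over
all C*-norms `γ` on `A ⊗_alg D` (the minimal norm is the least such) and all
C*-seminorms `δ` on `B ⊗_alg D` (the maximal norm is the greatest such). -/
def NuclearBound {A B : Type} [NonUnitalCStarAlgebra A] [NonUnitalCStarAlgebra B]
    (ρ : A →ₗ[ℂ] B) (K : ℝ) : Prop :=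
  ∀ (D : Type) [NonUnitalCStarAlgebra D],
    ∀ (sA : TensorProduct ℂ A D →+ TensorProduct ℂ A D)
      (sB : TensorProduct ℂ B D →+ TensorProduct ℂ B D)
      (γ : TensorProduct ℂ A D → ℝ) (δ : TensorProduct ℂ B D → ℝ),
      IsTensorStar sA → IsTensorStar sB → IsCStarNorm sA γ → IsCStarSeminorm sB δ →
      ∀ x, δ (TensorProduct.map ρ (LinearMap.id : D →ₗ[ℂ] D) x) ≤ K * γ x

/-- A linear map `ρ : A → B` between C*-algebras is nuclear if
`ρ ⊗ id : A ⊗_min D → B ⊗_max D` is bounded by some `K ≥ 0`, for all `D`. -/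
def IsNuclearMap {A B : Type} [NonUnitalCStarAlgebra A] [NonUnitalCStarAlgebra B]
    (ρ : A →ₗ[ℂ] B) : Prop :=
  ∃ K : ℝ, 0 ≤ K ∧ NuclearBound ρ K

/-- The nuclear norm `‖ρ‖_nuc` of a linear map between C*-algebras. -/
def nucNorm {A B : Type} [NonUnitalCStarAlgebra A] [NonUnitalCStarAlgebra B]
    (ρ : A →ₗ[ℂ] B) : ℝ :=
  sInf {K : ℝ | 0 ≤ K ∧ NuclearBound ρ K}

/-- `j : B → E` realizes `B` as a closed two-sided ideal of `E`. -/
structure IsIdealEmbedding {B E : Type} [NonUnitalCStarAlgebra B] [NonUnitalCStarAlgebra E]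
    (j : B →⋆ₙₐ[ℂ] E) : Prop where
  inj : Function.Injective j
  closed : IsClosed (Set.range j)
  mul_mem_left : ∀ (e : E) (b : B), ∃ b', j b' = e * j b
  mul_mem_right : ∀ (e : E) (b : B), ∃ b', j b' = j b * e

/-- The C*-identity on a seminormed star ring. -/
class PreCS (T : Type) [NonUnitalSeminormedRing T] [StarRing T] : Prop where
  le : ∀ x : T, ‖x‖ * ‖x‖ ≤ ‖star x * x‖

section compl
open UniformSpace UniformSpace.Completion Function

variable {T : Type} [NonUnitalSeminormedRing T]

/-- multiplication on the completion -/
@[reducible] def complMul : Mul (Completion T) :=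
  ⟨curry <| (isDenseInducing_coe.prodMap isDenseInducing_coe).extend ((↑) ∘ uncurry (· * ·))⟩

attribute [local instance] complMul

theorem complMul_coe (a b : T) : ((a * b : T) : Completion T) = a * b :=
  ((isDenseInducing_coe.prodMap isDenseInducing_coe).extend_eq
      ((continuous_coe T).comp (@continuous_mul T _ _ _)) (a, b)).symm

theorem complMul_cont : ContinuousMul (Completion T) where
  continuous_mul := by
    let m := (AddMonoidHom.mul : T →+ T →+ T).compr₂ toCompl
    have : Continuous fun p : T × T => m p.1 p.2 := (continuous_coe T).comp continuous_mul
    have di : IsDenseInducing (toCompl : T → Completion T) := isDenseInducing_coe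
    exact (di.extend_Z_bilin di this :)

attribute [local instance] complMul_cont

/-- completion ring -/
@[reducible] def complRing : NonUnitalNormedRing (Completion T) :=
  { (inferInstance : NormedAddCommGroup (Completion T)),
    (inferInstance : Mul (Completion T)) with
    zero_mul := fun a =>
      Completion.induction_on a (isClosed_eq (by fun_prop) continuous_const)
        fun a => by rw [← coe_zero, ← complMul_coe, zero_mul]
    mul_zero := fun a =>
      Completion.induction_on a (isClosed_eq (by fun_prop) continuous_const)
        fun a ↦ by rw [← coe_zero, ← complMul_coe, mul_zero]
    mul_assoc := fun a b c =>
      Completion.induction_on₃ a b c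
        (isClosed_eq (by fun_prop) (by fun_prop))
        fun a b c => by simp only [← complMul_coe, mul_assoc]
    left_distrib := fun a b c =>
      Completion.induction_on₃ a b c
        (isClosed_eq (by fun_prop) (by fun_prop))
        fun a b c => by simp only [← complMul_coe, ← coe_add, mul_add]
    right_distrib := fun a b c =>
      Completion.induction_on₃ a b c
        (isClosed_eq (by fun_prop) (by fun_prop))
        fun a b c => by simp only [← complMul_coe, ← coe_add, add_mul]
    norm_mul_le := fun a b =>
      Completion.induction_on₂ a b
        (isClosed_le (by fun_prop) (by fun_prop))
        fun a b => by simpa only [← complMul_coe, norm_coe] using norm_mul_le a b }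

attribute [local instance] complRing

variable [StarRing T] [PreCS T]

theorem cs_norm_star (x : T) : ‖star x‖ = ‖x‖ := by
  have key : ∀ y : T, ‖y‖ ≤ ‖star y‖ := by
    intro y
    by_cases h : ‖y‖ = 0
    · rw [h]; positivity
    · have h1 : ‖y‖ * ‖y‖ ≤ ‖star y‖ * ‖y‖ :=
        (PreCS.le y).trans (norm_mul_le _ _)
      exact le_of_mul_le_mul_right h1 (lt_of_le_of_ne (norm_nonneg _) (Ne.symm h))
  exact le_antisymm (by simpa using key (star x)) (key x)

theorem cs_star_uc : UniformContinuous (star : T → T) :=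
  (AddMonoidHomClass.isometry_of_norm (starAddEquiv : T ≃+ T) cs_norm_star).uniformContinuous

/-- completion star -/
@[reducible] def complStar : Star (Completion T) := ⟨Completion.map star⟩

attribute [local instance] complStar

theorem complStar_coe (a : T) : star (a : Completion T) = ((star a : T) : Completion T) :=
  Completion.map_coe cs_star_uc a

theorem complStar_cont : ContinuousStar (Completion T) := ⟨Completion.continuous_map⟩

attribute [local instance] complStar_cont

/-- completion star ring -/
@[reducible] def complStarRing : StarRing (Completion T) :=
  { (inferInstance : Star (Completion T)) with
    star_involutive := fun a =>
      Completion.induction_on a (isClosed_eq (by fun_prop) (by fun_prop))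
        fun a => by simp only [complStar_coe, star_star]
    star_mul := fun a b =>
      Completion.induction_on₂ a b (isClosed_eq (by fun_prop) (by fun_prop))
        fun a b => by
          show star ((a : Completion T) * b) = star (b : Completion T) * star (a : Completion T)
          simp only [← complMul_coe, complStar_coe, star_mul]
    star_add := fun a b =>
      Completion.induction_on₂ a b (isClosed_eq (by fun_prop) (by fun_prop))
        fun a b => by simp only [← coe_add, complStar_coe, star_add] }

variable [NormedSpace ℂ T] [IsScalarTower ℂ T T] [SMulCommClass ℂ T T] [StarModule ℂ T]

theorem compl_smul_cont (c : ℂ) : Continuous (fun x : Completion T => c • x) :=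
  (uniformContinuous_const_smul c).continuous

theorem compl_smul_mul (c : ℂ) (a b : Completion T) : (c • a) * b = c • (a * b) :=
  Completion.induction_on₂ a b
    (isClosed_eq (((compl_smul_cont c).comp continuous_fst).mul continuous_snd)
      ((compl_smul_cont c).comp (continuous_fst.mul continuous_snd)))
    fun a b => by simp only [← complMul_coe, ← coe_smul, smul_mul_assoc]

theorem compl_mul_smul (c : ℂ) (a b : Completion T) : c • (a * b) = a * (c • b) :=
  Completion.induction_on₂ a b
    (isClosed_eq ((compl_smul_cont c).comp (continuous_fst.mul continuous_snd))
      (continuous_fst.mul ((compl_smul_cont c).comp continuous_snd)))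
    fun a b => by simp only [← complMul_coe, ← coe_smul, mul_smul_comm]

theorem compl_star_smul (c : ℂ) (a : Completion T) : star (c • a) = star c • star a :=
  Completion.induction_on a
    (isClosed_eq (continuous_star.comp (compl_smul_cont c))
      ((compl_smul_cont (star c)).comp continuous_star))
    fun a => by simp only [complStar_coe, ← coe_smul, star_smul]

theorem compl_cs (a : Completion T) : ‖a‖ * ‖a‖ ≤ ‖star a * a‖ :=
  Completion.induction_on a (isClosed_le (by fun_prop) (by fun_prop))
    fun a => by
      simpa only [complStar_coe, ← complMul_coe, norm_coe] using PreCS.le a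

/-- completion C*-algebra -/
@[reducible] def complCStar : NonUnitalCStarAlgebra (Completion T) :=
  { complRing, complStarRing, (inferInstance : NormedSpace ℂ (Completion T)),
    (inferInstance : CompleteSpace (Completion T)) with
    norm_mul_self_le := compl_cs
    smul_assoc := compl_smul_mul
    smul_comm := compl_mul_smul
    star_smul := compl_star_smul }

/-- Monotonicity of the norm for sums of squares. -/
theorem cs_mono (u v w : T) (h : star u * u + star v * v = star w * w) : ‖u‖ ≤ ‖w‖ := by
  let := complCStar (T := T)
  let := CStarAlgebra.spectralOrder (Completion T)
  let := CStarAlgebra.spectralOrderedRing (Completion T)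
  have e : ∀ x : T, ((star x * x : T) : Completion T) = star (x : Completion T) * x := by
    intro x
    rw [complMul_coe, ← complStar_coe]
  have h2 := congrArg (fun t : T => (t : Completion T)) h
  simp only [coe_add, e] at h2
  have h3 : ‖star (u : Completion T) * u‖ ≤ ‖star (w : Completion T) * w‖ := by
    refine CStarAlgebra.norm_le_norm_of_nonneg_of_le (star_mul_self_nonneg _) ?_
    rw [← h2]
    exact le_add_of_nonneg_right (star_mul_self_nonneg _)
  rw [CStarRing.norm_star_mul_self, CStarRing.norm_star_mul_self] at h3
  have h5 : ‖(u : Completion T)‖ ≤ ‖(w : Completion T)‖ :=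
    le_of_not_gt fun hh => absurd h3 (not_le.mpr (mul_self_lt_mul_self (norm_nonneg _) hh))
  have h6 : ∀ x : T, ‖(x : Completion T)‖ = ‖x‖ := fun x => Completion.norm_coe x
  exact (h6 u) ▸ (h6 w) ▸ h5

end compl

theorem seminorm_mono {T : Type} [R : NonUnitalRing T] [Module ℂ T] [IsScalarTower ℂ T T]
    [SMulCommClass ℂ T T] (s : T →+ T) (δ : T → ℝ) (hδ : IsCStarSeminorm s δ)
    (hs1 : ∀ x, s (s x) = x) (hs2 : ∀ x y, s (x * y) = s y * s x)
    (hs3 : ∀ (c : ℂ) x, s (c • x) = star c • s x)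
    (u v w : T) (h : s u * u + s v * v = s w * w) : δ u ≤ δ w := by
  have h0 : δ 0 = 0 := by simpa using hδ.smul 0 0
  let g : AddGroupSeminorm T :=
    { toFun := δ
      map_zero' := h0
      add_le' := hδ.add_le
      neg' := fun x => by simpa using hδ.smul (-1) x }
  let G : SeminormedAddCommGroup T := g.toSeminormedAddCommGroup
  let _ : NonUnitalSeminormedRing T :=
    { R, G with
      norm_mul_le := hδ.mul_le }
  let _ : StarRing T :=
    { star := s
      star_involutive := hs1
      star_mul := hs2
      star_add := fun x y => map_add s x y }
  let _ : NormedSpace ℂ T := { norm_smul_le := fun c x => (hδ.smul c x).le }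
  have : StarModule ℂ T := ⟨hs3⟩
  have : PreCS T := ⟨fun x => by
    have := hδ.cstar x
    show δ x * δ x ≤ δ (s x * x)
    rw [this, sq]⟩
  exact cs_mono u v w h

section tens
variable {B D : Type} [NonUnitalCStarAlgebra B] [NonUnitalCStarAlgebra D]
  {s : TensorProduct ℂ B D →+ TensorProduct ℂ B D}

theorem ts_invol (hs : IsTensorStar s) (x) : s (s x) = x := by
  induction x with
  | zero => simp
  | add x y hx hy => simp [hx, hy]
  | tmul a d => simp [hs a d, hs (star a) (star d)]

theorem ts_mul (hs : IsTensorStar s) (x y) : s (x * y) = s y * s x := by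
  induction x with
  | zero => simp
  | add x x' hx hx' => simp [add_mul, mul_add, hx, hx']
  | tmul a d =>
    induction y with
    | zero => simp
    | add y y' hy hy' => simp [add_mul, mul_add, hy, hy']
    | tmul b e => simp [Algebra.TensorProduct.tmul_mul_tmul, hs _ _]

theorem ts_smul (hs : IsTensorStar s) (c : ℂ) (x) : s (c • x) = star c • s x := by
  induction x with
  | zero => simp
  | add x y hx hy => simp [smul_add, hx, hy]
  | tmul a d => rw [TensorProduct.smul_tmul', hs, hs, star_smul, TensorProduct.smul_tmul']

/-- Left multiplication by `b ⊗ 1`. -/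
def lm (D : Type) [NonUnitalCStarAlgebra D] (b : B) :
    TensorProduct ℂ B D →ₗ[ℂ] TensorProduct ℂ B D :=
  TensorProduct.map (LinearMap.mulLeft ℂ b) LinearMap.id

theorem lm_tmul (b a : B) (d : D) : lm D b (a ⊗ₜ[ℂ] d) = (b * a) ⊗ₜ[ℂ] d := rfl

theorem lm_star (hs : IsTensorStar s) (b : B) (x y : TensorProduct ℂ B D) :
    s (lm D b x) * y = s x * lm D (star b) y := by
  induction x with
  | zero => simp
  | add x x' hx hx' => simp only [map_add, add_mul, hx, hx']
  | tmul a d =>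
    induction y with
    | zero => simp
    | add y y' hy hy' => simp only [map_add, mul_add, hy, hy']
    | tmul b e => simp [lm_tmul, Algebra.TensorProduct.tmul_mul_tmul, hs _ _, mul_assoc]

theorem lm_mul (a b : B) (x : TensorProduct ℂ B D) : lm D a (lm D b x) = lm D (a * b) x := by
  induction x with
  | zero => simp
  | add x x' hx hx' => simp only [map_add, hx, hx']
  | tmul a d => simp [lm_tmul, mul_assoc]

theorem lm_sub (a b : B) (x : TensorProduct ℂ B D) : lm D (a - b) x = lm D a x - lm D b x := by
  induction x with
  | zero => simp
  | add x x' hx hx' => simp only [map_add, hx, hx']; abel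
  | tmul a d => simp [lm_tmul, sub_mul, TensorProduct.sub_tmul]

theorem lm_smul (c : ℂ) (b : B) (x : TensorProduct ℂ B D) : lm D (c • b) x = c • lm D b x := by
  induction x with
  | zero => simp
  | add x x' hx hx' => simp only [map_add, hx, hx', smul_add]
  | tmul a d => rw [lm_tmul, lm_tmul, smul_mul_assoc, TensorProduct.smul_tmul']

theorem exists_sqrt (b : B) : ∃ g : B, star g = g ∧
    (2 * (‖b‖ : ℂ)) • g - g * g = star b * b := by
  have hsa : IsSelfAdjoint (star b * b) := IsSelfAdjoint.star_mul_self b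
  let f : ℝ → ℝ := fun t => ‖b‖ - √(‖b‖ ^ 2 - t)
  have hf : Continuous f := by fun_prop
  have hf0 : f 0 = 0 := by simp [f]
  refine ⟨cfcₙ f (star b * b), (cfcₙ_predicate f (star b * b) : IsSelfAdjoint _), ?_⟩
  have h1 : cfcₙ (fun t => (2 * ‖b‖) * f t - f t * f t) (star b * b) = star b * b := by
    conv_rhs => rw [← cfcₙ_id' ℝ (star b * b)]
    apply cfcₙ_congr
    intro t ht
    have h2 := NonUnitalIsometricContinuousFunctionalCalculus.norm_quasispectrum_le (𝕜 := ℝ) (star b * b) ht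
    rw [CStarRing.norm_star_mul_self, Real.norm_eq_abs] at h2
    have h3 : 0 ≤ ‖b‖ ^ 2 - t := by nlinarith [le_abs_self t]
    have h4 := Real.sq_sqrt h3
    simp only [f]
    nlinarith
  rw [cfcₙ_sub _ _ _ (by fun_prop) (by simp [hf0]) (by fun_prop) (by simp [hf0]),
    cfcₙ_const_mul _ _ _ (by fun_prop) hf0,
    cfcₙ_mul _ _ _ (by fun_prop) hf0 (by fun_prop) hf0] at h1
  refine Eq.trans ?_ h1
  congr 1
  rw [← Complex.coe_smul]
  simp

theorem lm_bound (hs : IsTensorStar s) (δ : TensorProduct ℂ B D → ℝ)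
    (hδ : IsCStarSeminorm s δ) (b : B) (y) : δ (lm D b y) ≤ ‖b‖ * δ y := by
  obtain ⟨g, hg, hgb⟩ := exists_sqrt b
  have h := seminorm_mono s δ hδ (ts_invol hs) (ts_mul hs) (ts_smul hs)
    (lm D b y) ((‖b‖ : ℂ) • y - lm D g y) ((‖b‖ : ℂ) • y) ?_
  · rwa [hδ.smul, Complex.norm_real, norm_norm] at h
  · have e : s y * lm D (star b * b) y =
        (2 * (‖b‖ : ℂ)) • (s y * lm D g y) - s y * lm D (g * g) y := by
      rw [← hgb, lm_sub, lm_smul, mul_sub, mul_smul_comm]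
    have hc : star (‖b‖ : ℂ) = (‖b‖ : ℂ) := Complex.conj_ofReal _
    rw [lm_star hs, lm_mul, e, map_sub, ts_smul hs, hc, sub_mul, mul_sub, mul_sub,
      lm_star hs, lm_star hs, hg, lm_mul, map_smul]
    simp only [mul_smul_comm, smul_mul_assoc]
    module

end tens

theorem statement14 {A B E : Type} [NonUnitalCStarAlgebra A] [NonUnitalCStarAlgebra B]
    [NonUnitalCStarAlgebra E]
    (ψ : A →⋆ₙₐ[ℂ] E) (j : B →⋆ₙₐ[ℂ] E) (hj : IsIdealEmbedding j) :
    (∀ b : B, ∀ ρ : A →ₗ[ℂ] B, (∀ x : A, j (ρ x) = ψ x * j b) → IsNuclearMap ρ) ↔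
    (∀ b : B, ∀ ρ : A →ₗ[ℂ] B, (∀ x : A, j (ρ x) = star (j b) * ψ x * j b) →
      IsNuclearMap ρ) := by
  constructor
  · intro H b ρ hρ
    choose f hf using fun x => hj.mul_mem_left (ψ x) b
    let ρ' : A →ₗ[ℂ] B :=
      { toFun := f
        map_add' := fun x y => hj.inj (by simp [hf, add_mul])
        map_smul' := fun c x => hj.inj (by simp [hf, smul_mul_assoc]) }
    obtain ⟨K, hK, hb⟩ := H b ρ' hf
    refine ⟨‖star b‖ * K, by positivity, ?_⟩
    intro D _ sA sB γ δ hsA hsB hγ hδ x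
    have e : TensorProduct.map ρ (LinearMap.id : D →ₗ[ℂ] D) x =
        lm D (star b) (TensorProduct.map ρ' (LinearMap.id : D →ₗ[ℂ] D) x) := by
      have e1 : ρ = LinearMap.mulLeft ℂ (star b) ∘ₗ ρ' := by
        ext x
        apply hj.inj
        rw [hρ]
        show _ = j (star b * f x)
        rw [map_mul, hf, map_star, mul_assoc]
      rw [e1]
      induction x with
      | zero => simp
      | add x y hx hy => simp only [map_add, hx, hy]
      | tmul a d => rfl
    rw [e, mul_assoc]
    exact (lm_bound hsB δ hδ _ _).trans
      (mul_le_mul_of_nonneg_left (hb D sA sB γ δ hsA hsB hγ hδ x) (norm_nonneg _))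
  · intro H b ρ hρ
    obtain ⟨K, hK, hb⟩ := H b (LinearMap.mulLeft ℂ (star b) ∘ₗ ρ) (fun x => by
      show j (star b * ρ x) = _
      rw [map_mul, hρ, map_star, mul_assoc])
    refine ⟨√K, Real.sqrt_nonneg K, ?_⟩
    intro D _ sA sB γ δ hsA hsB hγ hδ x
    have key : ∀ x y : TensorProduct ℂ A D,
        sB (TensorProduct.map ρ (LinearMap.id : D →ₗ[ℂ] D) x) *
          TensorProduct.map ρ (LinearMap.id : D →ₗ[ℂ] D) y =
        TensorProduct.map (LinearMap.mulLeft ℂ (star b) ∘ₗ ρ) (LinearMap.id : D →ₗ[ℂ] D)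
          (sA x * y) := by
      intro x y
      induction x with
      | zero => simp
      | add x x' hx hx' => simp only [map_add, add_mul, hx, hx']
      | tmul a d =>
        induction y with
        | zero => simp
        | add y y' hy hy' => simp only [map_add, mul_add, hy, hy']
        | tmul c e =>
          rw [TensorProduct.map_tmul, TensorProduct.map_tmul, hsA, hsB,
            Algebra.TensorProduct.tmul_mul_tmul, Algebra.TensorProduct.tmul_mul_tmul,
            TensorProduct.map_tmul]
          congr 1
          apply hj.inj
          show _ = j (star b * ρ (star a * c))
          rw [map_mul, map_mul, map_star, map_star, hρ, hρ, hρ, map_mul, map_star, star_mul]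
          simp only [mul_assoc]
    have h1 := hb D sA sB γ δ hsA hsB hγ hδ (sA x * x)
    rw [← key, hδ.cstar, hγ.cstar] at h1
    refine (sq_le_sq₀ (hδ.nonneg _) (mul_nonneg (Real.sqrt_nonneg _) (hγ.nonneg x))).1 ?_
    rw [mul_pow, Real.sq_sqrt hK]
    exact h1

end
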